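/- arXiv:1004.0043 — 2 statements merged into one kernel-verified Lean document; each statement's English description precedes it below -/
import Mathlib

section
/- For m ≥ 3, the number of ranking patterns of unidimensional unfolding models with generic m-tuples of objects is r(m) = (m!/2)·r_0(m) = |ch(M_m)|/2, half the number of chambers of the mid-hyperplane arrangement M_m. -/
/-- The union of the hyperplanes of the braid arrangement `B_m` in `ℝ^m`:
`x_i = x_j` for `1 ≤ i < j ≤ m`. -/
def braidUnion (m : ℕ) : Set (Fin m → ℝ) :=
  ⋃ i : Fin m, ⋃ j : Fin m, ⋃ _ : i < j, {x | x i = x j}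

/-- The union of the hyperplanes of the arrangement `N_m` in `ℝ^m`:
`x_i + x_j = x_k + x_l` for quadruples of distinct indices `(i,j,k,l)` with
`i < j`, `i < k < l`. -/
def midUnion (m : ℕ) : Set (Fin m → ℝ) :=
  ⋃ i : Fin m, ⋃ j : Fin m, ⋃ k : Fin m, ⋃ l : Fin m,
    ⋃ _ : i < j, ⋃ _ : i < k, ⋃ _ : k < l, ⋃ _ : j ≠ k, ⋃ _ : j ≠ l,
      {x | x i + x j = x k + x l}

/-- The union of the hyperplanes of the mid-hyperplane arrangement
`M_m = B_m ∪ N_m`. -/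
def midHyperplaneUnion (m : ℕ) : Set (Fin m → ℝ) :=
  braidUnion m ∪ midUnion m

/-- The chamber `C_0 = {x : x_1 < ⋯ < x_m}` of the braid arrangement. -/
def C0 (m : ℕ) : Set (Fin m → ℝ) := {x | StrictMono x}

/-- The ranking pattern of the unidimensional unfolding model with objects
`x_1, …, x_m ∈ ℝ`: the set of rankings `(i_1 ⋯ i_m)` (permutations of
`{1,…,m}`, where `σ k = i_k`) such that
`|y - x_{i_1}| < ⋯ < |y - x_{i_m}|` for some `y ∈ ℝ`. -/
def RPUF {m : ℕ} (x : Fin m → ℝ) : Set (Equiv.Perm (Fin m)) :=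
  {σ | ∃ y : ℝ, ∀ k l : Fin m, k < l → |y - x (σ k)| < |y - x (σ l)|}

/-- The chambers of an arrangement with union of hyperplanes `U`: the
connected components of the complement of `U`. -/
def chambersOf {m : ℕ} (U : Set (Fin m → ℝ)) : Set (Set (Fin m → ℝ)) :=
  {C | ∃ y ∈ Uᶜ, C = connectedComponentIn Uᶜ y}

/-- `r_0(m)`: the number of ranking patterns of unidimensional unfolding
models with generic `m`-tuples such that `x_1 < ⋯ < x_m`. -/
noncomputable def r0 (m : ℕ) : ℕ :=
  {R : Set (Equiv.Perm (Fin m)) | ∃ x ∈ C0 m \ midUnion m, R = RPUF x}.ncard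

/-- `r(m)`: the number of ranking patterns of unidimensional unfolding models
with generic `m`-tuples of objects. -/
noncomputable def rNum (m : ℕ) : ℕ :=
  {R : Set (Equiv.Perm (Fin m)) |
    ∃ x ∈ (midHyperplaneUnion m)ᶜ, R = RPUF x}.ncard

/-- The pair sums `x i + x j` (`i ≠ j`) are pairwise distinct. -/
def DistinctPairSums {m : ℕ} (x : Fin m → ℝ) : Prop :=
  ∀ i j k l, i ≠ j → k ≠ l → x i + x j = x k + x l → (i = k ∧ j = l) ∨ (i = l ∧ j = k)

/-- The pair sums of `x` and of `x'` are ordered in the same way. -/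
def SamePairSumOrder {m : ℕ} (x x' : Fin m → ℝ) : Prop :=
  ∀ i j k l, i ≠ j → k ≠ l → (x i + x j < x k + x l ↔ x' i + x' j < x' k + x' l)

theorem exists_ne_ne {m : ℕ} (hm : 3 ≤ m) (i j : Fin m) : ∃ k, k ≠ i ∧ k ≠ j := by
  obtain ⟨k, hk⟩ := Finset.exists_mem_notMem_of_card_lt_card
    (s := {i, j}) (t := (Finset.univ : Finset (Fin m))) (by
      have := Finset.card_le_two (a := i) (b := j)
      simp; omega)
  exact ⟨k, by simpa using hk.2⟩

theorem DistinctPairSums.injective {m : ℕ} (hm : 3 ≤ m) {x : Fin m → ℝ}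
    (h : DistinctPairSums x) : Function.Injective x := by
  intro i j hij
  obtain ⟨k, hki, hkj⟩ := exists_ne_ne hm i j
  have := h i k j k hki.symm hkj.symm (by rw [hij])
  grind

theorem mem_braidUnion {m : ℕ} {x : Fin m → ℝ} :
    x ∈ braidUnion m ↔ ¬ Function.Injective x := by
  simp only [braidUnion, Set.mem_iUnion, Set.mem_ofPred_eq, exists_prop, Function.Injective]
  push Not
  constructor
  · rintro ⟨i, j, hij, h⟩
    exact ⟨i, j, h, hij.ne⟩
  · rintro ⟨i, j, h, hij⟩
    rcases lt_or_gt_of_ne hij with h' | h'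
    · exact ⟨i, j, h', h⟩
    · exact ⟨j, i, h', h.symm⟩

theorem mem_midUnion {m : ℕ} {x : Fin m → ℝ} :
    x ∈ midUnion m ↔ ∃ i j k l, i ≠ j ∧ k ≠ l ∧ i ≠ k ∧ i ≠ l ∧ j ≠ k ∧ j ≠ l ∧
      x i + x j = x k + x l := by
  simp only [midUnion, Set.mem_iUnion, Set.mem_ofPred_eq, exists_prop]
  constructor
  · rintro ⟨i, j, k, l, h1, h2, h3, h4, h5, h⟩
    exact ⟨i, j, k, l, h1.ne, h3.ne, h2.ne, (h2.trans h3).ne, h4, h5, h⟩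
  · have ordered : ∀ i j k l : Fin m, i < j → k < l → i ≠ k → i ≠ l → j ≠ k → j ≠ l →
        x i + x j = x k + x l → ∃ i j k l : Fin m, i < j ∧ i < k ∧ k < l ∧ j ≠ k ∧ j ≠ l ∧
          x i + x j = x k + x l := by
      intro i j k l hij hkl h1 h2 h3 h4 h
      rcases lt_or_gt_of_ne h1 with h' | h'
      · exact ⟨i, j, k, l, hij, h', hkl, h3, h4, h⟩
      · exact ⟨k, l, i, j, hkl, h', hij, h2.symm, h4.symm, h.symm⟩
    rintro ⟨i, j, k, l, hij, hkl, h1, h2, h3, h4, h⟩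
    rcases lt_or_gt_of_ne hij with hij | hij <;> rcases lt_or_gt_of_ne hkl with hkl | hkl
    · exact ordered i j k l hij hkl h1 h2 h3 h4 h
    · exact ordered i j l k hij hkl h2 h1 h4 h3 (by linarith)
    · exact ordered j i k l hij hkl h3 h4 h1 h2 (by linarith)
    · exact ordered j i l k hij hkl h4 h3 h2 h1 (by linarith)

theorem mem_compl_midHyperplaneUnion {m : ℕ} (hm : 3 ≤ m) {x : Fin m → ℝ} :
    x ∈ (midHyperplaneUnion m)ᶜ ↔ DistinctPairSums x := by
  rw [midHyperplaneUnion, Set.mem_compl_iff, Set.mem_union, mem_braidUnion, mem_midUnion]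
  push Not
  constructor
  · rintro ⟨hinj, h⟩ i j k l hij hkl heq
    by_cases h1 : i = k
    · subst h1; exact Or.inl ⟨rfl, hinj (by linarith)⟩
    by_cases h2 : i = l
    · subst h2; exact Or.inr ⟨rfl, hinj (by linarith)⟩
    by_cases h3 : j = k
    · subst h3; exact Or.inr ⟨hinj (by linarith), rfl⟩
    by_cases h4 : j = l
    · subst h4; exact Or.inl ⟨hinj (by linarith), rfl⟩
    exact absurd heq (h i j k l hij hkl h1 h2 h3 h4)
  · intro h
    refine ⟨h.injective hm, fun i j k l hij hkl h1 h2 _ _ heq => ?_⟩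
    rcases h i j k l hij hkl heq with h' | h'
    · exact h1 h'.1
    · exact h2 h'.1

theorem mem_C0_diff_midUnion {m : ℕ} (hm : 3 ≤ m) {x : Fin m → ℝ} :
    x ∈ C0 m \ midUnion m ↔ StrictMono x ∧ DistinctPairSums x := by
  rw [← mem_compl_midHyperplaneUnion hm, midHyperplaneUnion, Set.mem_compl_iff, Set.mem_union,
    mem_braidUnion]
  constructor
  · rintro ⟨h1, h2⟩
    exact ⟨h1, fun h => h.elim (fun h => h (StrictMono.injective h1)) h2⟩
  · rintro ⟨h1, h2⟩
    exact ⟨h1, fun h => h2 (Or.inr h)⟩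

theorem DistinctPairSums.comp_perm {m : ℕ} {x : Fin m → ℝ} (h : DistinctPairSums x)
    (σ : Equiv.Perm (Fin m)) : DistinctPairSums (x ∘ σ) := by
  intro i j k l hij hkl heq
  simpa using h (σ i) (σ j) (σ k) (σ l) (by simpa) (by simpa) heq

theorem DistinctPairSums.neg {m : ℕ} {x : Fin m → ℝ} (h : DistinctPairSums x) :
    DistinctPairSums (-x) := by
  intro i j k l hij hkl heq
  simp only [Pi.neg_apply] at heq
  exact h i j k l hij hkl (by linarith)

theorem SamePairSumOrder.symm {m : ℕ} {x x' : Fin m → ℝ} (h : SamePairSumOrder x x') :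
    SamePairSumOrder x' x :=
  fun i j k l hij hkl => (h i j k l hij hkl).symm

theorem SamePairSumOrder.comp_perm {m : ℕ} {x x' : Fin m → ℝ} (h : SamePairSumOrder x x')
    (σ : Equiv.Perm (Fin m)) : SamePairSumOrder (x ∘ σ) (x' ∘ σ) :=
  fun i j k l hij hkl => h (σ i) (σ j) (σ k) (σ l) (by simpa) (by simpa)

theorem SamePairSumOrder.lt_iff {m : ℕ} (hm : 3 ≤ m) {x x' : Fin m → ℝ}
    (h : SamePairSumOrder x x') (i j : Fin m) : x i < x j ↔ x' i < x' j := by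
  obtain ⟨k, hki, hkj⟩ := exists_ne_ne hm i j
  simpa using h i k j k hki.symm hkj.symm

theorem connectedComponentIn_eq_iff_samePairSumOrder {m : ℕ} (hm : 3 ≤ m) {x x' : Fin m → ℝ}
    (hx : DistinctPairSums x) (hx' : DistinctPairSums x') :
    connectedComponentIn (midHyperplaneUnion m)ᶜ x =
      connectedComponentIn (midHyperplaneUnion m)ᶜ x' ↔ SamePairSumOrder x x' := by
  have hxU := (mem_compl_midHyperplaneUnion hm).2 hx
  have hxU' := (mem_compl_midHyperplaneUnion hm).2 hx'
  constructor
  · intro h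
    have hmem : x ∈ connectedComponentIn (midHyperplaneUnion m)ᶜ x := mem_connectedComponentIn hxU
    have hmem' : x' ∈ connectedComponentIn (midHyperplaneUnion m)ᶜ x :=
      h ▸ mem_connectedComponentIn hxU'
    have transfer : ∀ u ∈ connectedComponentIn (midHyperplaneUnion m)ᶜ x,
        ∀ v ∈ connectedComponentIn (midHyperplaneUnion m)ᶜ x, ∀ i j k l, i ≠ j → k ≠ l →
        u i + u j < u k + u l → v i + v j < v k + v l := by
      intro u hu v hv i j k l hij hkl hlt
      by_contra hge
      have hcont : ContinuousOn (fun z : Fin m → ℝ => z i + z j - (z k + z l))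
          (connectedComponentIn (midHyperplaneUnion m)ᶜ x) := by fun_prop
      obtain ⟨z, hz, hz0⟩ := isPreconnected_connectedComponentIn.intermediate_value hu hv hcont
        (show (0 : ℝ) ∈ Set.Icc _ _ from ⟨by linarith, by linarith⟩)
      have hzd := (mem_compl_midHyperplaneUnion hm).1 (connectedComponentIn_subset _ _ hz)
      rcases hzd i j k l hij hkl (sub_eq_zero.1 hz0) with ⟨rfl, rfl⟩ | ⟨rfl, rfl⟩ <;> linarith
    exact fun i j k l hij hkl => ⟨transfer x hmem x' hmem' i j k l hij hkl,
      transfer x' hmem' x hmem i j k l hij hkl⟩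
  · intro h
    have hseg : segment ℝ x x' ⊆ (midHyperplaneUnion m)ᶜ := by
      rintro z ⟨a, b, ha, hb, hab, rfl⟩
      refine (mem_compl_midHyperplaneUnion hm).2 fun i j k l hij hkl heq => ?_
      simp only [Pi.add_apply, Pi.smul_apply, smul_eq_mul] at heq
      have pos : ∀ s t : ℝ, 0 < s → 0 < t → 0 < a * s + b * t := by
        intro s t hs ht
        rcases ha.eq_or_lt with rfl | ha
        · obtain rfl : b = 1 := by linarith
          simpa
        · exact add_pos_of_pos_of_nonneg (mul_pos ha hs) (mul_nonneg hb ht.le)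
      rcases lt_trichotomy (x i + x j) (x k + x l) with hlt | he | hlt
      · have := pos _ _ (sub_pos.2 hlt) (sub_pos.2 ((h i j k l hij hkl).1 hlt))
        linarith
      · exact hx i j k l hij hkl he
      · have := pos _ _ (sub_pos.2 hlt) (sub_pos.2 ((h k l i j hkl hij).1 hlt))
        linarith
    exact connectedComponentIn_eq ((convex_segment x x').isPreconnected.subset_connectedComponentIn
      (left_mem_segment ℝ x x') hseg (right_mem_segment ℝ x x'))

theorem abs_sub_lt_abs_sub_iff {y a b : ℝ} :
    |y - a| < |y - b| ↔ (a < b ∧ 2 * y < a + b) ∨ (b < a ∧ a + b < 2 * y) := by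
  rw [← sq_lt_sq]
  have key : (y - b) ^ 2 - (y - a) ^ 2 = (b - a) * (a + b - 2 * y) := by ring
  rw [← sub_pos, key, mul_pos_iff]
  simp only [sub_pos, sub_neg]

theorem SamePairSumOrder.RPUF_subset {m : ℕ} (hm : 3 ≤ m) {x x' : Fin m → ℝ}
    (h : SamePairSumOrder x x') : RPUF x ⊆ RPUF x' := by
  classical
  rintro σ ⟨y, hy⟩
  let pairs : Finset (Fin m × Fin m) := Finset.univ.filter fun p => p.1 < p.2
  let below := (pairs.filter fun p => x (σ p.2) < x (σ p.1)).image
    fun p => x' (σ p.1) + x' (σ p.2)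
  let above := (pairs.filter fun p => x (σ p.1) < x (σ p.2)).image
    fun p => x' (σ p.1) + x' (σ p.2)
  obtain ⟨c, hc, hc'⟩ := Finset.exists_between' below above (by
    simp only [below, above, pairs, Finset.mem_image, Finset.mem_filter, Finset.mem_univ, true_and]
    rintro _ ⟨p, ⟨hp, hpx⟩, rfl⟩ _ ⟨q, ⟨hq, hqx⟩, rfl⟩
    have h1 := abs_sub_lt_abs_sub_iff.1 (hy _ _ hp)
    have h2 := abs_sub_lt_abs_sub_iff.1 (hy _ _ hq)
    refine (h _ _ _ _ (σ.injective.ne hp.ne) (σ.injective.ne hq.ne)).1 ?_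
    rcases h1 with h1 | h1 <;> rcases h2 with h2 | h2 <;> linarith)
  refine ⟨c / 2, fun k l hkl => abs_sub_lt_abs_sub_iff.2 ?_⟩
  rcases abs_sub_lt_abs_sub_iff.1 (hy k l hkl) with ⟨h1, -⟩ | ⟨h1, -⟩
  · refine Or.inl ⟨(h.lt_iff hm _ _).1 h1, ?_⟩
    have := hc' _ (Finset.mem_image_of_mem _ (show (k, l) ∈ _ by simp [pairs, hkl, h1]))
    simp only at this
    linarith
  · refine Or.inr ⟨(h.lt_iff hm _ _).1 h1, ?_⟩
    have := hc _ (Finset.mem_image_of_mem _ (show (k, l) ∈ _ by simp [pairs, hkl, h1]))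
    simp only at this
    linarith

theorem SamePairSumOrder.RPUF_eq {m : ℕ} (hm : 3 ≤ m) {x x' : Fin m → ℝ}
    (h : SamePairSumOrder x x') : RPUF x = RPUF x' :=
  (h.RPUF_subset hm).antisymm (h.symm.RPUF_subset hm)

theorem RPUF_neg {m : ℕ} (x : Fin m → ℝ) : RPUF (-x) = RPUF x := by
  have sub : ∀ z : Fin m → ℝ, RPUF z ⊆ RPUF (-z) := by
    rintro z σ ⟨y, hy⟩
    refine ⟨-y, fun k l hkl => ?_⟩
    have := hy k l hkl
    rw [abs_sub_lt_abs_sub_iff] at this ⊢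
    simp only [Pi.neg_apply]
    rcases this with h | h
    · exact Or.inr ⟨by linarith, by linarith⟩
    · exact Or.inl ⟨by linarith, by linarith⟩
  exact (by simpa using sub (-x) : RPUF (-x) ⊆ RPUF x).antisymm (sub x)

/-- If the distances from `y` to the objects are pairwise distinct, they define a ranking. -/
theorem exists_mem_RPUF_of_injective {m : ℕ} {x : Fin m → ℝ} {y : ℝ}
    (hy : Function.Injective fun i => |y - x i|) :
    ∃ σ ∈ RPUF x, ∀ i j, |y - x i| < |y - x j| → σ.symm i < σ.symm j := by
  let σ := Tuple.sort fun i => |y - x i|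
  have hmono : StrictMono ((fun i => |y - x i|) ∘ σ) :=
    (Tuple.monotone_sort _).strictMono_of_injective (hy.comp σ.injective)
  refine ⟨σ, ⟨y, fun k l hkl => hmono hkl⟩, fun i j hij => hmono.lt_iff_lt.1 ?_⟩
  simpa using hij

theorem exists_mem_RPUF_iff {m : ℕ} {x : Fin m → ℝ} (hx : Function.Injective x)
    (i j k l : Fin m) :
    (∃ σ ∈ RPUF x, σ.symm i < σ.symm j ∧ σ.symm k < σ.symm l) ↔
      ∃ y : ℝ, |y - x i| < |y - x j| ∧ |y - x k| < |y - x l| := by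
  constructor
  · rintro ⟨σ, ⟨y, hy⟩, h1, h2⟩
    exact ⟨y, by simpa using hy _ _ h1, by simpa using hy _ _ h2⟩
  · rintro ⟨y, h1, h2⟩
    have hopen : IsOpen {y : ℝ | |y - x i| < |y - x j| ∧ |y - x k| < |y - x l|} :=
      IsOpen.and (isOpen_lt (by fun_prop) (by fun_prop)) (isOpen_lt (by fun_prop) (by fun_prop))
    have hdense : Dense (Set.range fun p : Fin m × Fin m => (x p.1 + x p.2) / 2)ᶜ :=
      (Set.finite_range _).countable.dense_compl ℝ
    obtain ⟨z, ⟨hz1, hz2⟩, hz⟩ := hdense.inter_open_nonempty _ hopen ⟨y, h1, h2⟩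
    obtain ⟨σ, hσ, h⟩ := exists_mem_RPUF_of_injective (x := x) (y := z) (by
      intro a b hab
      rcases abs_eq_abs.1 hab with hab | hab
      · exact hx (by linarith)
      · exact absurd ⟨(a, b), by simp only; linarith⟩ hz)
    exact ⟨σ, hσ, h _ _ hz1, h _ _ hz2⟩

theorem not_exists_abs_lt_iff_between {m : ℕ} {x : Fin m → ℝ} (hx : Function.Injective x)
    {i j k : Fin m} (hij : i ≠ j) (hjk : j ≠ k) :
    (¬ ∃ y : ℝ, |y - x i| < |y - x j| ∧ |y - x k| < |y - x j|) ↔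
      (x i < x j ∧ x j < x k) ∨ (x k < x j ∧ x j < x i) := by
  simp only [abs_sub_lt_abs_sub_iff]
  constructor
  · intro h
    by_contra hb
    apply h
    rcases lt_or_gt_of_ne (hx.ne hij) with h1 | h1 <;> rcases lt_or_gt_of_ne (hx.ne hjk) with h2 | h2
    · exact absurd (Or.inl ⟨h1, h2⟩) hb
    · refine ⟨min (x i + x j) (x k + x j) / 2 - 1, Or.inl ⟨h1, ?_⟩, Or.inl ⟨h2, ?_⟩⟩
      · linarith [min_le_left (x i + x j) (x k + x j)]
      · linarith [min_le_right (x i + x j) (x k + x j)]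
    · refine ⟨max (x i + x j) (x k + x j) / 2 + 1, Or.inr ⟨h1, ?_⟩, Or.inr ⟨h2, ?_⟩⟩
      · linarith [le_max_left (x i + x j) (x k + x j)]
      · linarith [le_max_right (x i + x j) (x k + x j)]
    · exact absurd (Or.inr ⟨h2, h1⟩) hb
  · rintro (⟨h1, h2⟩ | ⟨h1, h2⟩) ⟨y, h3 | h3, h4 | h4⟩ <;> linarith

theorem add_lt_add_iff_exists_abs_lt {a b c d : ℝ} (hab : a < b) (hcd : c < d) :
    a + b < c + d ↔ ∃ y : ℝ, |y - b| < |y - a| ∧ |y - c| < |y - d| := by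
  simp only [abs_sub_lt_abs_sub_iff]
  constructor
  · intro h
    exact ⟨(a + b + (c + d)) / 4, Or.inr ⟨hab, by linarith⟩, Or.inl ⟨hcd, by linarith⟩⟩
  · rintro ⟨y, h1 | h1, h2 | h2⟩ <;> linarith

/-- Betweenness determines a linear order up to reversal. -/
theorem lt_iff_lt_or_lt_iff_gt_of_between {m : ℕ} {x x' : Fin m → ℝ} (hx : Function.Injective x)
    (hx' : Function.Injective x')
    (h : ∀ i j k, (x i < x j ∧ x j < x k ∨ x k < x j ∧ x j < x i) ↔
      (x' i < x' j ∧ x' j < x' k ∨ x' k < x' j ∧ x' j < x' i)) :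
    (∀ i j, x i < x j ↔ x' i < x' j) ∨ (∀ i j, x i < x j ↔ x' j < x' i) := by
  rcases isEmpty_or_nonempty (Fin m) with he | he
  · exact Or.inl fun i => he.elim i
  obtain ⟨a, ha⟩ := Finite.exists_min x
  by_cases hmin : ∀ i, x' a ≤ x' i
  · left
    intro i j
    have := h a i j
    have := ha i; have := ha j; have := hmin i; have := hmin j
    have := @hx a i; have := @hx a j; have := @hx' a i; have := @hx' a j
    grind
  · right
    push Not at hmin
    obtain ⟨b, hb⟩ := hmin
    have hmax : ∀ i, x' i ≤ x' a := by
      intro i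
      have := h b a i
      have := ha i; have := ha b
      grind
    intro i j
    have := h a i j
    have := ha i; have := ha j; have := hmax i; have := hmax j
    have := @hx a i; have := @hx a j; have := @hx' a i; have := @hx' a j
    grind

theorem samePairSumOrder_of_RPUF_eq_of_lt_iff {m : ℕ} {x x' : Fin m → ℝ}
    (hx : Function.Injective x) (hx' : Function.Injective x') (hR : RPUF x = RPUF x')
    (hlt : ∀ i j, x i < x j ↔ x' i < x' j) : SamePairSumOrder x x' := by
  have ordered : ∀ i j k l, x i < x j → x k < x l →
      (x i + x j < x k + x l ↔ x' i + x' j < x' k + x' l) := by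
    intro i j k l hij hkl
    rw [add_lt_add_iff_exists_abs_lt hij hkl, ← exists_mem_RPUF_iff hx, hR,
      exists_mem_RPUF_iff hx',
      ← add_lt_add_iff_exists_abs_lt ((hlt _ _).1 hij) ((hlt _ _).1 hkl)]
  intro i j k l hij hkl
  rcases lt_or_gt_of_ne (hx.ne hij) with h1 | h1 <;> rcases lt_or_gt_of_ne (hx.ne hkl) with h2 | h2
  · exact ordered i j k l h1 h2
  · rw [add_comm (x k), add_comm (x' k)]; exact ordered i j l k h1 h2
  · rw [add_comm (x i), add_comm (x' i)]; exact ordered j i k l h1 h2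
  · rw [add_comm (x i), add_comm (x' i), add_comm (x k), add_comm (x' k)]
    exact ordered j i l k h1 h2

/-- The ranking pattern determines the order of the objects up to reversal. -/
theorem lt_iff_lt_or_lt_iff_gt_of_RPUF_eq {m : ℕ} {x x' : Fin m → ℝ}
    (hx : Function.Injective x) (hx' : Function.Injective x') (hR : RPUF x = RPUF x') :
    (∀ i j, x i < x j ↔ x' i < x' j) ∨ (∀ i j, x i < x j ↔ x' j < x' i) := by
  refine lt_iff_lt_or_lt_iff_gt_of_between hx hx' fun i j k => ?_
  by_cases hij : i = j
  · subst hij; simp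
  by_cases hjk : j = k
  · subst hjk; simp
  rw [← not_exists_abs_lt_iff_between hx hij hjk,
    ← not_exists_abs_lt_iff_between hx' hij hjk, ← exists_mem_RPUF_iff hx, hR,
    exists_mem_RPUF_iff hx']

theorem samePairSumOrder_iff_of_lt {m : ℕ} (hm : 3 ≤ m) {x x' : Fin m → ℝ}
    (hx : Function.Injective x) (hx' : Function.Injective x') {a b : Fin m} (hab : a ≠ b) :
    SamePairSumOrder x x' ↔ RPUF x = RPUF x' ∧ (x a < x b ↔ x' a < x' b) := by
  constructor
  · exact fun h => ⟨h.RPUF_eq hm, h.lt_iff hm a b⟩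
  · rintro ⟨hR, h⟩
    rcases lt_iff_lt_or_lt_iff_gt_of_RPUF_eq hx hx' hR with hlt | hlt
    · exact samePairSumOrder_of_RPUF_eq_of_lt_iff hx hx' hR hlt
    · have h1 := hlt a b
      have h2 := hx'.ne hab
      have h3 := hlt b a
      have h4 := hx.ne hab
      grind

theorem ncard_image_eq_ncard_image_of_eq_iff {α β γ : Type*} {s : Set α} {f : α → β} {g : α → γ}
    (h : ∀ a ∈ s, ∀ b ∈ s, f a = f b ↔ g a = g b) : (f '' s).ncard = (g '' s).ncard := by
  refine Set.ncard_congr (fun _ hc => g hc.choose)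
    (fun _ hc => Set.mem_image_of_mem g hc.choose_spec.1) ?_ ?_
  · intro c d hc hd hcd
    rw [← hc.choose_spec.2, ← hd.choose_spec.2]
    exact (h _ hc.choose_spec.1 _ hd.choose_spec.1).2 hcd
  · rintro _ ⟨a, ha, rfl⟩
    have hfa : f a ∈ f '' s := Set.mem_image_of_mem f ha
    exact ⟨f a, hfa, (h _ hfa.choose_spec.1 _ ha).1 hfa.choose_spec.2⟩

theorem rNum_eq_ncard_image {m : ℕ} (hm : 3 ≤ m) :
    rNum m = (RPUF '' {x : Fin m → ℝ | DistinctPairSums x}).ncard := by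
  rw [rNum]
  congr 1
  ext R
  simp only [mem_compl_midHyperplaneUnion hm, Set.mem_image, Set.mem_ofPred_eq, eq_comm]

theorem r0_eq_ncard_image {m : ℕ} (hm : 3 ≤ m) :
    r0 m = (RPUF '' {x : Fin m → ℝ | StrictMono x ∧ DistinctPairSums x}).ncard := by
  rw [r0]
  congr 1
  ext R
  simp only [mem_C0_diff_midUnion hm, Set.mem_image, Set.mem_ofPred_eq, eq_comm]

theorem chambersOf_eq_image {m : ℕ} (hm : 3 ≤ m) :
    chambersOf (midHyperplaneUnion m) = connectedComponentIn (midHyperplaneUnion m)ᶜ ''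
      {x : Fin m → ℝ | DistinctPairSums x} := by
  ext C
  simp only [chambersOf, mem_compl_midHyperplaneUnion hm, Set.mem_image, Set.mem_ofPred_eq, eq_comm]

theorem ncard_chambersOf_eq_two_mul_rNum {m : ℕ} (hm : 3 ≤ m) :
    (chambersOf (midHyperplaneUnion m)).ncard = 2 * rNum m := by
  let a : Fin m := ⟨0, by omega⟩
  let b : Fin m := ⟨1, by omega⟩
  have hab : a ≠ b := by simp [a, b]
  have himage : (fun x : Fin m → ℝ => (RPUF x, x a < x b)) '' {x | DistinctPairSums x} =
      (RPUF '' {x : Fin m → ℝ | DistinctPairSums x}) ×ˢ (Set.univ : Set Prop) := by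
    ext ⟨R, p⟩
    simp only [Set.mem_image, Set.mem_ofPred_eq, Prod.mk.injEq, Set.mem_prod, Set.mem_univ, and_true]
    constructor
    · rintro ⟨x, hx, hR, -⟩
      exact ⟨x, hx, hR⟩
    · rintro ⟨x, hx, hR⟩
      by_cases hp : (x a < x b) = p
      · exact ⟨x, hx, hR, hp⟩
      · refine ⟨-x, hx.neg, (RPUF_neg x).trans hR, ?_⟩
        have := (hx.injective hm).ne hab
        simp only [Pi.neg_apply, neg_lt_neg_iff]
        grind
  rw [chambersOf_eq_image hm, ncard_image_eq_ncard_image_of_eq_iff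
    (g := fun x : Fin m → ℝ => (RPUF x, x a < x b)), himage, Set.ncard_prod, rNum_eq_ncard_image hm,
    mul_comm, Set.ncard_univ, Nat.card_eq_fintype_card, Fintype.card_prop]
  intro x hx x' hx'
  rw [connectedComponentIn_eq_iff_samePairSumOrder hm hx hx',
    samePairSumOrder_iff_of_lt hm (hx.injective hm) (hx'.injective hm) hab, Prod.mk.injEq,
    eq_iff_iff (a := x a < x b)]

theorem sort_eq_of_strictMono_comp {m : ℕ} {x : Fin m → ℝ} {σ : Equiv.Perm (Fin m)}
    (h : StrictMono (x ∘ σ)) : Tuple.sort x = σ := by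
  have hx : Function.Injective x := by
    simpa using h.injective
  have := Tuple.unique_monotone (Tuple.monotone_sort x) h.monotone
  ext1 i
  exact hx (congrFun this i)

theorem strictMono_comp_sort {m : ℕ} {x : Fin m → ℝ} (hx : Function.Injective x) :
    StrictMono (x ∘ Tuple.sort x) :=
  (Tuple.monotone_sort x).strictMono_of_injective (hx.comp (Tuple.sort x).injective)

theorem samePairSumOrder_iff_sort {m : ℕ} (hm : 3 ≤ m) {x x' : Fin m → ℝ}
    (hx : Function.Injective x) (hx' : Function.Injective x') :
    SamePairSumOrder x x' ↔ Tuple.sort x = Tuple.sort x' ∧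
      RPUF (x ∘ Tuple.sort x) = RPUF (x' ∘ Tuple.sort x') := by
  have hs := strictMono_comp_sort hx
  have hs' := strictMono_comp_sort hx'
  constructor
  · intro h
    have hsort : Tuple.sort x' = Tuple.sort x :=
      sort_eq_of_strictMono_comp fun i j hij => (h.lt_iff hm _ _).1 (hs hij)
    rw [hsort]
    exact ⟨rfl, (h.comp_perm _).RPUF_eq hm⟩
  · rintro ⟨hsort, hR⟩
    rw [← hsort] at hR hs'
    have := (samePairSumOrder_of_RPUF_eq_of_lt_iff hs.injective hs'.injective hR fun i j => by
      rw [hs.lt_iff_lt, hs'.lt_iff_lt]).comp_perm (Tuple.sort x).symm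
    simpa [Function.comp_assoc] using this

theorem ncard_chambersOf_eq_factorial_mul_r0 {m : ℕ} (hm : 3 ≤ m) :
    (chambersOf (midHyperplaneUnion m)).ncard = m.factorial * r0 m := by
  have himage : (fun x : Fin m → ℝ => (Tuple.sort x, RPUF (x ∘ Tuple.sort x))) ''
      {x | DistinctPairSums x} = (Set.univ : Set (Equiv.Perm (Fin m))) ×ˢ
        (RPUF '' {x : Fin m → ℝ | StrictMono x ∧ DistinctPairSums x}) := by
    ext ⟨σ, R⟩
    simp only [Set.mem_image, Set.mem_ofPred_eq, Prod.mk.injEq, Set.mem_prod, Set.mem_univ, true_and]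
    constructor
    · rintro ⟨x, hx, -, hR⟩
      exact ⟨_, ⟨strictMono_comp_sort (hx.injective hm), hx.comp_perm _⟩, hR⟩
    · rintro ⟨x, ⟨hmono, hx⟩, hR⟩
      have hcomp : (x ∘ σ.symm) ∘ σ = x := by simp [Function.comp_assoc]
      have hsort : Tuple.sort (x ∘ σ.symm) = σ :=
        sort_eq_of_strictMono_comp (by rwa [hcomp])
      exact ⟨x ∘ σ.symm, hx.comp_perm _, hsort, by rwa [hsort, hcomp]⟩
  rw [chambersOf_eq_image hm, ncard_image_eq_ncard_image_of_eq_iff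
    (g := fun x : Fin m → ℝ => (Tuple.sort x, RPUF (x ∘ Tuple.sort x))), himage, Set.ncard_prod,
    r0_eq_ncard_image hm, Set.ncard_univ, Nat.card_perm, Nat.card_fin]
  intro x hx x' hx'
  rw [connectedComponentIn_eq_iff_samePairSumOrder hm hx hx',
    samePairSumOrder_iff_sort hm (hx.injective hm) (hx'.injective hm), Prod.mk.injEq]

/-- Theorem: for `m ≥ 3`, `r(m) = (m!/2)·r_0(m) = |ch(M_m)|/2` (stated
multiplicatively). -/
theorem r_eq_half_chambers (m : ℕ) (hm : 3 ≤ m) :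
    2 * rNum m = Nat.factorial m * r0 m ∧
    2 * rNum m = (chambersOf (midHyperplaneUnion m)).ncard := by
  rw [← ncard_chambersOf_eq_two_mul_rNum hm]
  exact ⟨ncard_chambersOf_eq_factorial_mul_r0 hm, rfl⟩
end

section
/- Let C and C′ be chambers of the mid-hyperplane arrangement M_m with C′ ≠ C and C′ ≠ −C (where −C = {−x : x ∈ C}). Then for every x ∈ C and x′ ∈ C′, RP^UF(x) ≠ RP^UF(x′). -/
theorem abs_sub_lt_abs_sub_iff_of_lt {a b : ℝ} (h : a < b) (y : ℝ) :
    |y - a| < |y - b| ↔ 2 * y < a + b := by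
  rw [← sq_lt_sq]
  constructor <;> intro h' <;> nlinarith

theorem abs_sub_lt_abs_sub_iff_of_gt {a b : ℝ} (h : a < b) (y : ℝ) :
    |y - b| < |y - a| ↔ a + b < 2 * y := by
  rw [← sq_lt_sq]
  constructor <;> intro h' <;> nlinarith

/-- If `a` is preferred to `b` at `p` and the preference is reversed at `q ≥ p`,
then `a < b`. -/
theorem lt_of_preference_reversal {a b p q : ℝ} (hpq : p ≤ q)
    (hp : |p - a| < |p - b|) (hq : |q - b| < |q - a|) : a < b := by
  rw [← sq_lt_sq] at hp hq
  by_contra! hab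
  nlinarith [mul_nonneg (sub_nonneg.2 hpq) (sub_nonneg.2 hab)]

theorem injective_of_notMem_braidUnion {m : ℕ} {x : Fin m → ℝ}
    (hx : x ∉ braidUnion m) : Function.Injective x := by
  intro i j hij
  by_contra hne
  apply hx
  simp only [braidUnion, Set.mem_iUnion, Set.mem_ofPred_eq]
  rcases lt_or_gt_of_ne hne with h | h
  · exact ⟨i, j, h, hij⟩
  · exact ⟨j, i, h, hij.symm⟩

theorem neg_mem_midHyperplaneUnion {m : ℕ} {x : Fin m → ℝ}
    (hx : x ∈ midHyperplaneUnion m) : -x ∈ midHyperplaneUnion m := by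
  simp only [midHyperplaneUnion, braidUnion, midUnion, Set.mem_union, Set.mem_iUnion,
    Set.mem_ofPred_eq, Pi.neg_apply] at hx ⊢
  rcases hx with ⟨i, j, h, hx⟩ | ⟨i, j, k, l, h1, h2, h3, h4, h5, hx⟩
  · exact Or.inl ⟨i, j, h, by linarith⟩
  · exact Or.inr ⟨i, j, k, l, h1, h2, h3, h4, h5, by linarith⟩

/-- An ideal point giving a strict ranking can be chosen in any open interval. -/
theorem exists_mem_Ioo_injective_abs_sub {m : ℕ} {x : Fin m → ℝ}
    (hx : Function.Injective x) {a b : ℝ} (hab : a < b) :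
    ∃ y ∈ Set.Ioo a b, Function.Injective fun i => |y - x i| := by
  have hfin : (Set.range fun p : Fin m × Fin m => (x p.1 + x p.2) / 2).Finite :=
    Set.finite_range _
  obtain ⟨y, hy, hy'⟩ := ((Set.Ioo_infinite hab).sdiff hfin).nonempty
  refine ⟨y, hy, fun i j hij => ?_⟩
  rcases abs_eq_abs.1 hij with h | h
  · exact hx (by linarith)
  · exact absurd ⟨(i, j), by simp only; linarith⟩ hy'

/-- If the ranking pattern of `x` is contained in that of `x'`, then every open interval
contains an ideal point whose preferences for `x` are the preferences of some ideal point
for `x'`. -/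
theorem exists_preference_eq {m : ℕ} {x x' : Fin m → ℝ} (hx : Function.Injective x)
    (hR : RPUF x ⊆ RPUF x') {a b : ℝ} (hab : a < b) :
    ∃ y ∈ Set.Ioo a b, ∃ y', ∀ i j, |y - x i| < |y - x j| → |y' - x' i| < |y' - x' j| := by
  obtain ⟨y, hy, hinj⟩ := exists_mem_Ioo_injective_abs_sub hx hab
  have hmono : StrictMono ((fun i => |y - x i|) ∘ Tuple.sort fun i => |y - x i|) :=
    (Tuple.monotone_sort _).strictMono_of_injective (hinj.comp (Equiv.injective _))
  generalize (Tuple.sort fun i => |y - x i|) = σ at hmono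
  obtain ⟨y', hy'⟩ := hR ⟨y, fun k l hkl => hmono hkl⟩
  refine ⟨y, hy, y', fun i j hij => ?_⟩
  have h : σ.symm i < σ.symm j := by
    rw [← hmono.lt_iff_lt]
    simpa using hij
  simpa using hy' _ _ h

theorem strictMono_or_strictAnti_of_RPUF_subset {m : ℕ} {x x' : Fin m → ℝ}
    (hx : Function.Injective x) (hR : RPUF x ⊆ RPUF x') :
    (∀ i j, x i < x j → x' i < x' j) ∨ (∀ i j, x i < x j → x' j < x' i) := by
  obtain ⟨B, hB⟩ := (Set.finite_range x).bddAbove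
  obtain ⟨A, hA⟩ := (Set.finite_range x).bddBelow
  obtain ⟨p, ⟨-, hpA⟩, p', hp⟩ := exists_preference_eq hx hR (sub_one_lt A)
  obtain ⟨q, ⟨hqB, -⟩, q', hq⟩ := exists_preference_eq hx hR (lt_add_one B)
  have hA' : ∀ i, A ≤ x i := fun i => hA ⟨i, rfl⟩
  have hB' : ∀ i, x i ≤ B := fun i => hB ⟨i, rfl⟩
  have hp' : ∀ i j, x i < x j → |p' - x' i| < |p' - x' j| := fun i j h =>
    hp i j ((abs_sub_lt_abs_sub_iff_of_lt h p).2 (by linarith [hA' i, hA' j]))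
  have hq' : ∀ i j, x i < x j → |q' - x' j| < |q' - x' i| := fun i j h =>
    hq j i ((abs_sub_lt_abs_sub_iff_of_gt h q).2 (by linarith [hB' i, hB' j]))
  rcases le_total p' q' with h | h
  · exact Or.inl fun i j hij => lt_of_preference_reversal h (hp' i j hij) (hq' i j hij)
  · exact Or.inr fun i j hij => lt_of_preference_reversal h (hq' i j hij) (hp' i j hij)

/-- For equally ordered tuples, the ranking pattern determines the order of midpoints. -/
theorem add_lt_add_of_RPUF_subset {m : ℕ} {x x' : Fin m → ℝ} (hx : Function.Injective x)
    (hR : RPUF x ⊆ RPUF x') (hord : ∀ i j, x i < x j → x' i < x' j)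
    {i j k l : Fin m} (hij : i ≠ j) (hkl : k ≠ l) (h : x i + x j < x k + x l) :
    x' i + x' j < x' k + x' l := by
  wlog h1 : x i < x j generalizing i j
  · have := this hij.symm (by linarith) (lt_of_le_of_ne (not_lt.1 h1) (hx.ne hij.symm))
    linarith
  wlog h2 : x k < x l generalizing k l
  · have := this hkl.symm (by linarith) (lt_of_le_of_ne (not_lt.1 h2) (hx.ne hkl.symm))
    linarith
  obtain ⟨y, ⟨hy1, hy2⟩, y', hy'⟩ := exists_preference_eq hx hR (div_lt_div_of_pos_right h two_pos)
  have e1 := (abs_sub_lt_abs_sub_iff_of_gt (hord i j h1) y').1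
    (hy' j i ((abs_sub_lt_abs_sub_iff_of_gt h1 y).2 (by linarith)))
  have e2 := (abs_sub_lt_abs_sub_iff_of_lt (hord k l h2) y').1
    (hy' k l ((abs_sub_lt_abs_sub_iff_of_lt h2 y).2 (by linarith)))
  linarith

theorem segment_subset_compl_midHyperplaneUnion {m : ℕ} {x x' : Fin m → ℝ}
    (hx : x ∉ midHyperplaneUnion m) (hR : RPUF x ⊆ RPUF x')
    (hord : ∀ i j, x i < x j → x' i < x' j) :
    segment ℝ x x' ⊆ (midHyperplaneUnion m)ᶜ := by
  have hinj : Function.Injective x :=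
    injective_of_notMem_braidUnion fun h => hx (Or.inl h)
  have key : ∀ {s t a b a' b' : ℝ}, 0 ≤ s → 0 ≤ t → s + t = 1 → a < b → a' < b' →
      s * a + t * a' < s * b + t * b' := by
    intro s t a b a' b' hs ht hst h h'
    rcases hs.eq_or_lt with rfl | hs'
    · obtain rfl : t = 1 := by linarith
      linarith
    · nlinarith [mul_lt_mul_of_pos_left h hs', mul_le_mul_of_nonneg_left h'.le ht]
  rintro z ⟨s, t, hs, ht, hst, rfl⟩ hz
  simp only [midHyperplaneUnion, braidUnion, midUnion, Set.mem_union, Set.mem_iUnion,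
    Set.mem_ofPred_eq, Pi.add_apply, Pi.smul_apply, smul_eq_mul] at hz
  rcases hz with ⟨i, j, h, hz⟩ | ⟨i, j, k, l, h1, h2, h3, h4, h5, hz⟩
  · rcases lt_or_gt_of_ne (hinj.ne h.ne) with h' | h'
    · linarith [key hs ht hst h' (hord _ _ h')]
    · linarith [key hs ht hst h' (hord _ _ h')]
  · have hne : x i + x j ≠ x k + x l := by
      intro he
      apply hx
      simp only [midHyperplaneUnion, midUnion, Set.mem_union, Set.mem_iUnion,
        Set.mem_ofPred_eq]
      exact Or.inr ⟨i, j, k, l, h1, h2, h3, h4, h5, he⟩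
    rcases lt_or_gt_of_ne hne with h' | h'
    · linarith [key hs ht hst h' (add_lt_add_of_RPUF_subset hinj hR hord h1.ne h3.ne h')]
    · linarith [key hs ht hst h' (add_lt_add_of_RPUF_subset hinj hR hord h3.ne h1.ne h')]

theorem connectedComponentIn_eq_of_RPUF_subset {m : ℕ} {x x' : Fin m → ℝ}
    (hx : x ∉ midHyperplaneUnion m) (hR : RPUF x ⊆ RPUF x')
    (hord : ∀ i j, x i < x j → x' i < x' j) :
    connectedComponentIn (midHyperplaneUnion m)ᶜ x =
      connectedComponentIn (midHyperplaneUnion m)ᶜ x' :=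
  connectedComponentIn_eq <|
    (convex_segment x x').isPreconnected.subset_connectedComponentIn
      (left_mem_segment ℝ x x') (segment_subset_compl_midHyperplaneUnion hx hR hord)
      (right_mem_segment ℝ x x')

theorem neg_image_connectedComponentIn_compl_midHyperplaneUnion {m : ℕ} {x : Fin m → ℝ}
    (hx : x ∉ midHyperplaneUnion m) :
    (fun v => -v) '' connectedComponentIn (midHyperplaneUnion m)ᶜ x =
      connectedComponentIn (midHyperplaneUnion m)ᶜ (-x) := by
  have h := (Homeomorph.neg (Fin m → ℝ)).image_connectedComponentIn
    (s := (midHyperplaneUnion m)ᶜ) hx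
  have himg : Homeomorph.neg (Fin m → ℝ) '' (midHyperplaneUnion m)ᶜ =
      (midHyperplaneUnion m)ᶜ := by
    ext v
    constructor
    · rintro ⟨w, hw, rfl⟩ hv
      exact hw (by simpa using neg_mem_midHyperplaneUnion hv)
    · intro hv
      exact ⟨-v, fun hw => hv (by simpa using neg_mem_midHyperplaneUnion hw), by simp⟩
  rw [himg] at h
  exact h

/-- If `C, C'` are chambers of the mid-hyperplane arrangement `M_m` with
`C' ≠ C` and `C' ≠ -C`, then the ranking patterns of points of `C` and `C'`
are distinct. -/
theorem ranking_pattern_ne_of_distinct_chambers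
    (m : ℕ) (C C' : Set (Fin m → ℝ))
    (hC : C ∈ chambersOf (midHyperplaneUnion m))
    (hC' : C' ∈ chambersOf (midHyperplaneUnion m))
    (hne : C' ≠ C) (hneg : C' ≠ (fun v => -v) '' C) :
    ∀ x ∈ C, ∀ x' ∈ C', RPUF x ≠ RPUF x' := by
  rintro x hx x' hx' hR
  obtain ⟨y, -, rfl⟩ := hC
  obtain ⟨y', -, rfl⟩ := hC'
  have hxU : x ∉ midHyperplaneUnion m := connectedComponentIn_subset _ _ hx
  rw [connectedComponentIn_eq hx, connectedComponentIn_eq hx'] at hne hneg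
  rcases strictMono_or_strictAnti_of_RPUF_subset
    (injective_of_notMem_braidUnion fun h => hxU (Or.inl h)) hR.subset with h | h
  · exact hne (connectedComponentIn_eq_of_RPUF_subset hxU hR.subset h).symm
  · apply hneg
    rw [neg_image_connectedComponentIn_compl_midHyperplaneUnion hxU]
    refine (connectedComponentIn_eq_of_RPUF_subset
      (fun hU => hxU (by simpa using neg_mem_midHyperplaneUnion hU))
      ((RPUF_neg x).trans hR).subset fun i j hij => h j i ?_).symm
    simpa using hij
end
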